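/- Let a < b be coprime positive integers. The simplicial complex Âss(a,b) collapses onto its subcomplex Ass(a,b). -/

import Mathlib

/-- `S(a,b) = { ⌊ib/a⌋ : i = 1, …, a-1 }`. -/
def Sab (a b : ℕ) : Finset ℕ := (Finset.Icc 1 (a - 1)).image (fun i => i * b / a)

/-- A diagonal of the polygon `P_{b+1}` with boundary points `0, 1, …, b`:
a pair `i < j` with `j - i ≥ 2` and `(i, j) ≠ (0, b)`. -/
def IsDiagonal (b i j : ℕ) : Prop := i + 2 ≤ j ∧ j ≤ b ∧ ¬(i = 0 ∧ j = b)

/-- A diagonal `ij` is `a,b`-admissible if it separates `j - i - 1` and `b - j + i`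
boundary points, both of which lie in `S(a,b)`. -/
def Admissible (a b : ℕ) (d : ℕ × ℕ) : Prop :=
  IsDiagonal b d.1 d.2 ∧ d.2 - d.1 - 1 ∈ Sab a b ∧ b - d.2 + d.1 ∈ Sab a b

/-- Two diagonals `ij` and `km` cross if `i < k < j < m` or `k < i < m < j`. -/
def Crosses (d d' : ℕ × ℕ) : Prop :=
  (d.1 < d'.1 ∧ d'.1 < d.2 ∧ d.2 < d'.2) ∨ (d'.1 < d.1 ∧ d.1 < d'.2 ∧ d'.2 < d.2)

/-- An `a,b`-Dyck path: a north/east lattice path from `(0,0)` to `(b,a)` staying weakly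
above `y = (a/b) x`.  It is encoded by the height `h u` of its unique east step over the
column interval `[u, u+1]`, for `0 ≤ u < b`; we normalize `h u = a` for `u ≥ b`. -/
structure DyckPath (a b : ℕ) where
  h : ℕ → ℕ
  mono : Monotone h
  norm : ∀ x, b ≤ x → h x = a
  above : ∀ x, x < b → a * (x + 1) ≤ b * h x

/-- The lattice point `(x, y)` lies on `D` at the bottom of a north step of `D`. -/
def BottomNorth (a b : ℕ) (D : DyckPath a b) (x y : ℕ) : Prop :=
  x ≤ b ∧ (if x = 0 then 0 else D.h (x - 1)) ≤ y ∧ y < D.h x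

/-- The laser of slope `a/b` fired northeast from the lattice point `(x, y)` of `D` first
hits `D` in the interior of the east step whose right endpoint has `x`-coordinate `k`;
the associated laser diagonal is `d(P) = (x, k)`.  The laser passes strictly below the
right endpoint of every earlier east step and strictly above the one it hits. -/
def IsLaserDiag (a b : ℕ) (D : DyckPath a b) (x y k : ℕ) : Prop :=
  x < k ∧ k ≤ b ∧ b * D.h (k - 1) < b * y + a * (k - x) ∧
    ∀ u, x ≤ u → u + 1 < k → b * y + a * (u + 1 - x) < b * D.h u

/-- `F(D)`: the set of laser diagonals `d(P)` of the lattice points `P ≠ (0,0)` at the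
bottoms of north steps of `D`. -/
def FD (a b : ℕ) (D : DyckPath a b) : Set (ℕ × ℕ) :=
  { d | ∃ y, BottomNorth a b D d.1 y ∧ (d.1, y) ≠ (0, 0) ∧ IsLaserDiag a b D d.1 y d.2 }

/-- A finite abstract simplicial complex on the ground set `E`: a downward closed
collection of finite subsets of `E`. -/
structure AbsCplx (E : Type*) where
  faces : Set (Finset E)
  down : ∀ F ∈ faces, ∀ F' ⊆ F, F' ∈ faces

/-- The rational associahedron `Âss(a,b)`: faces are the sets of pairwise noncrossing
`a,b`-admissible diagonals. -/
def hatAss (a b : ℕ) : AbsCplx (ℕ × ℕ) where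
  faces := { F | (∀ d ∈ F, Admissible a b d) ∧ ∀ d ∈ F, ∀ d' ∈ F, ¬Crosses d d' }
  down := fun F hF F' hsub =>
    ⟨fun d hd => hF.1 d (hsub hd), fun d hd d' hd' => hF.2 d (hsub hd) d' (hsub hd')⟩

/-- The rational associahedron `Ass(a,b)`: faces are the subsets of the sets `F(D)`,
as `D` ranges over `a,b`-Dyck paths. -/
def Ass (a b : ℕ) : AbsCplx (ℕ × ℕ) where
  faces := { F | ∃ D : DyckPath a b, ∀ d ∈ F, d ∈ FD a b D }
  down := fun F hF F' hsub =>
    let ⟨D, hD⟩ := hF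
    ⟨D, fun d hd => hD d (hsub hd)⟩

/-- `Δ'` is obtained from `Δ` by an elementary collapse: there is a facet `F` and a face
`F' ⊂ F` with `|F'| = |F| - 1` such that `F` is the unique face of `Δ` properly containing
`F'`, and `Δ' = Δ - {F, F'}`. -/
def IsElemCollapse {E : Type*} (Δ Δ' : AbsCplx E) : Prop :=
  ∃ F F' : Finset E, F ∈ Δ.faces ∧ F' ∈ Δ.faces ∧ F' ⊂ F ∧ F'.card + 1 = F.card ∧
    (∀ G ∈ Δ.faces, F ⊆ G → G = F) ∧
    (∀ G ∈ Δ.faces, F' ⊂ G → G = F) ∧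
    Δ'.faces = Δ.faces \ {F, F'}

/-- `Δ` collapses onto `Δ'` if `Δ'` is obtained from `Δ` by a finite sequence of
elementary collapses. -/
def CollapsesOnto {E : Type*} (Δ Δ' : AbsCplx E) : Prop :=
  Relation.ReflTransGen (fun X Y => IsElemCollapse X Y) Δ Δ'

/-- The vertical gap, scaled by `b`, between an `a,b`-laser from column `i` and the right
endpoint of the east step it hits, when that endpoint lies in column `j`. -/
def laserGap (a b i j : ℕ) : ℕ := a * (j - i) % b

/-- A set of diagonals is laser ordered if among its diagonals with a common right endpoint
the shorter ones have the larger laser gap. -/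
def LaserOrdered (a b : ℕ) (F : Finset (ℕ × ℕ)) : Prop :=
  ∀ i p j, (i, j) ∈ F → (p, j) ∈ F → i < p → laserGap a b i j < laserGap a b p j

section Matching

variable {E : Type*}

theorem AbsCplx.eq_of_faces_eq {Δ Δ' : AbsCplx E} (h : Δ.faces = Δ'.faces) : Δ = Δ' := by
  cases Δ; cases Δ'; cases h; rfl

/-- A complex collapses onto a subcomplex as soon as the remaining faces are perfectly
matched by toggling a vertex `e F`, and a weight on the vertices makes the matching acyclic. -/
theorem collapsesOnto_of_matching [DecidableEq E] (Δ' : AbsCplx E) (e : Finset E → E)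
    (w : E → ℕ) (hw : ∀ x, 0 < w x) (R : Finset (Finset E)) :
    ∀ Δ : AbsCplx E, Δ'.faces ⊆ Δ.faces → (∀ F, F ∈ R ↔ F ∈ Δ.faces ∧ F ∉ Δ'.faces) →
      (∀ F ∈ R, insert (e F) F ∈ R ∧ F.erase (e F) ∈ R ∧
        e (insert (e F) F) = e F ∧ e (F.erase (e F)) = e F) →
      (∀ F ∈ R, ∀ G ∈ R, F ⊆ G → e F = e G ∨ ∃ x ∈ G, x ∉ F ∧ w (e G) < w x) →
      CollapsesOnto Δ Δ' := by
  induction R using Finset.strongInduction with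
  | H R ih =>
  intro Δ hsub hR htog hacyc
  rcases R.eq_empty_or_nonempty with rfl | ⟨F₀, hF₀⟩
  · have : Δ = Δ' := AbsCplx.eq_of_faces_eq <| Set.Subset.antisymm
      (fun F hF => by
        by_contra h
        exact absurd ((hR F).2 ⟨hF, h⟩) (Finset.notMem_empty F)) hsub
    rw [this]
    exact Relation.ReflTransGen.refl
  have hlow : ∀ G ∈ R, G.erase (e G) ∈ R.filter (fun F => e F ∉ F) := fun G hG => by
    obtain ⟨-, h, -, h'⟩ := htog G hG
    simp [h, h']
  obtain ⟨F, hFB, hmax⟩ := Finset.exists_max_image (R.filter (fun F => e F ∉ F))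
    (fun F => ∑ x ∈ F, w x) ⟨_, hlow F₀ hF₀⟩
  obtain ⟨hFR, heF⟩ := Finset.mem_filter.1 hFB
  obtain ⟨hTR, -, heT, -⟩ := htog F hFR
  have hlt : ∀ {A B : Finset E}, A ⊂ B → ∑ x ∈ A, w x < ∑ x ∈ B, w x := fun {A B} h => by
    obtain ⟨x, hx, hx'⟩ := Finset.exists_of_ssubset h
    exact Finset.sum_lt_sum_of_subset h.1 hx hx' (hw x) fun _ _ _ => Nat.zero_le _
  have huniq : ∀ G ∈ Δ.faces, F ⊂ G → G = insert (e F) F := by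
    intro G hG hFG
    have hGR : G ∈ R := (hR G).2 ⟨hG, fun h => ((hR F).1 hFR).2 (Δ'.down G h F hFG.1)⟩
    by_cases heG : e G ∈ G
    · have hle := hmax _ (hlow G hGR)
      rcases hacyc F hFR G hGR hFG.1 with h | ⟨x, hxG, hxF, hx⟩
      · have hs : F ⊆ G.erase (e G) := fun y hy =>
          Finset.mem_erase.2 ⟨fun hy' => heF (by rw [h, ← hy']; exact hy), hFG.1 hy⟩
        rcases hs.eq_or_ssubset with h' | h'
        · rw [h]
          nth_rewrite 1 [h']
          exact (Finset.insert_erase heG).symm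
        · exact absurd (hlt h') (not_lt.2 hle)
      · have h1 := Finset.sum_erase_add G w heG
        have h2 : ∑ y ∈ insert x F, w y ≤ ∑ y ∈ G, w y :=
          Finset.sum_le_sum_of_subset (Finset.insert_subset hxG hFG.1)
        rw [Finset.sum_insert hxF] at h2
        omega
    · exact absurd (hlt hFG) (not_lt.2 (hmax G (Finset.mem_filter.2 ⟨hGR, heG⟩)))
  have hFT : F ⊂ insert (e F) F := Finset.ssubset_insert heF
  have hfacet : ∀ G ∈ Δ.faces, insert (e F) F ⊆ G → G = insert (e F) F :=
    fun G hG h => huniq G hG (hFT.trans_subset h)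
  let Δ₁ : AbsCplx E :=
    { faces := Δ.faces \ {insert (e F) F, F}
      down := by
        rintro G ⟨hG, hG'⟩ H hHG
        simp only [Set.mem_insert_iff, Set.mem_singleton_iff, not_or] at hG'
        refine ⟨Δ.down G hG H hHG, ?_⟩
        rintro (rfl | hH)
        · exact hG'.1 (hfacet G hG hHG)
        · rw [Set.mem_singleton_iff] at hH
          subst hH
          exact hG'.1 (huniq G hG (hHG.ssubset_of_ne fun h => hG'.2 h.symm)) }
  have hmem : ∀ G, G ∈ (R.erase F).erase (insert (e F) F) ↔
      G ∈ R ∧ G ≠ F ∧ G ≠ insert (e F) F := fun G => by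
    simp only [Finset.mem_erase]
    tauto
  refine Relation.ReflTransGen.head (b := Δ₁)
    ⟨insert (e F) F, F, ((hR _).1 hTR).1, ((hR _).1 hFR).1, hFT,
      (Finset.card_insert_of_notMem heF).symm, hfacet, huniq, rfl⟩ ?_
  refine ih ((R.erase F).erase (insert (e F) F))
    ((Finset.erase_subset _ _).trans_ssubset (Finset.erase_ssubset hFR)) Δ₁ ?_ ?_ ?_ ?_
  · intro G hG
    refine ⟨hsub hG, ?_⟩
    rintro (rfl | rfl)
    · exact ((hR _).1 hTR).2 hG
    · exact ((hR _).1 hFR).2 hG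
  · intro G
    rw [hmem, hR]
    simp only [Δ₁, Set.mem_sdiff, Set.mem_insert_iff, Set.mem_singleton_iff, not_or]
    tauto
  · intro G hG
    obtain ⟨hGR, hGF, hGT⟩ := (hmem G).1 hG
    obtain ⟨h1, h2, h3, h4⟩ := htog G hGR
    refine ⟨(hmem _).2 ⟨h1, fun h => ?_, fun h => ?_⟩,
      (hmem _).2 ⟨h2, fun h => ?_, fun h => ?_⟩, h3, h4⟩
    · rw [h] at h3
      exact heF (by rw [h3, ← h]; exact Finset.mem_insert_self _ _)
    · rw [h, heT] at h3
      by_cases heG : e G ∈ G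
      · exact hGT (by rw [← h, Finset.insert_eq_self.2 heG])
      · apply hGF
        have h5 := Finset.erase_insert heG
        rw [h, ← h3, Finset.erase_insert heF] at h5
        exact h5.symm
    · rw [h] at h4
      by_cases heG : e G ∈ G
      · exact hGT (by rw [h4, ← h, Finset.insert_erase heG])
      · exact hGF (by rw [← h, Finset.erase_eq_of_notMem heG])
    · rw [h, heT] at h4
      have : e G ∈ G.erase (e G) := by
        rw [h, ← h4]
        exact Finset.mem_insert_self _ _
      simp at this
  · exact fun G hG H hH => hacyc G ((hmem G).1 hG).1 H ((hmem H).1 hH).1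

end Matching

section Admissibility

variable {a b : ℕ}

theorem laserGap_eq {i j r s : ℕ} (h : a * (j - i) = b * r + s) (hs : s < b) :
    laserGap a b i j = s := by
  rw [laserGap, h, Nat.mul_add_mod, Nat.mod_eq_of_lt hs]

theorem laserGap_succ (hab : a < b) (u : ℕ) : laserGap a b u (u + 1) = a := by
  rw [laserGap, Nat.add_sub_cancel_left, mul_one, Nat.mod_eq_of_lt hab]

theorem laserGap_pos (hcop : Nat.Coprime a b) {i j : ℕ} (hij : i < j) (hlt : j - i < b) :
    0 < laserGap a b i j := by
  refine Nat.pos_of_ne_zero fun h => ?_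
  have h1 : b ∣ j - i := hcop.symm.dvd_of_dvd_mul_left (Nat.dvd_of_mod_eq_zero h)
  have := Nat.le_of_dvd (by omega) h1
  omega

theorem mem_Sab_of_bounds {n r : ℕ} (hr : 1 ≤ r) (hra : r < a) (h1 : a * n ≤ r * b)
    (h2 : r * b < a * (n + 1)) : n ∈ Sab a b := by
  refine Finset.mem_image.2 ⟨r, Finset.mem_Icc.2 (by omega), ?_⟩
  refine Nat.div_eq_of_lt_le ?_ ?_
  · rwa [mul_comm]
  · rwa [mul_comm (n + 1)]

theorem admissible_iff (ha : 0 < a) (hab : a < b) (hcop : Nat.Coprime a b) {i j : ℕ} :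
    Admissible a b (i, j) ↔
      i < j ∧ j ≤ b ∧ 0 < laserGap a b i j ∧ laserGap a b i j < a := by
  constructor
  · rintro ⟨⟨h1, h2, h3⟩, h4, -⟩
    dsimp only at h1 h2 h3 h4
    obtain ⟨r, hr, hrj⟩ := Finset.mem_image.1 h4
    rw [Finset.mem_Icc] at hr
    have hpos : 0 < laserGap a b i j := laserGap_pos hcop (by omega) (by omega)
    refine ⟨by omega, h2, hpos, ?_⟩
    have hd := Nat.div_add_mod (r * b) a
    have hm := Nat.mod_lt (r * b) ha
    have hm0 : r * b % a ≠ 0 := fun h => by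
      have h5 : a ∣ r := hcop.dvd_of_dvd_mul_right (Nat.dvd_of_mod_eq_zero h)
      have := Nat.le_of_dvd (by omega) h5
      omega
    rw [hrj] at hd
    have h6 : a * (j - i) = a * (j - i - 1) + a := by
      rw [← mul_add_one]
      congr 1
      omega
    rw [laserGap_eq (r := r) (s := a - r * b % a) (by rw [mul_comm b r]; omega) (by omega)]
    omega
  · rintro ⟨h1, h2, h3, h4⟩
    have hd := Nat.div_add_mod (a * (j - i)) b
    change b * _ + laserGap a b i j = _ at hd
    generalize a * (j - i) / b = r at hd
    have hr1 : 1 ≤ r := by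
      by_contra h
      have hr0 : r = 0 := by omega
      have : a * 1 ≤ a * (j - i) := Nat.mul_le_mul_left a (by omega)
      rw [hr0] at hd
      omega
    have h5 : a * (j - i) ≤ a * b := Nat.mul_le_mul_left a (by omega)
    have hra : r < a := by
      by_contra h
      have : b * a ≤ b * r := Nat.mul_le_mul_left b (by omega)
      rw [mul_comm b a] at this
      omega
    have h6 : i + 2 ≤ j := by
      by_contra h
      have : j = i + 1 := by omega
      have h7 : laserGap a b i j = a := by
        rw [this, laserGap_succ hab]
      omega
    have h7 : a * (j - i) = a * (j - i - 1) + a := by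
      rw [← mul_add_one]
      congr 1
      omega
    have h8 : a * (b - j + i) + a * (j - i) = a * b := by
      rw [← mul_add]
      congr 1
      omega
    have h9 : (a - r) * b + b * r = a * b := by
      rw [mul_comm b r, ← add_mul]
      congr 1
      omega
    refine ⟨⟨h6, h2, ?_⟩, ?_, ?_⟩
    · dsimp only
      rintro ⟨rfl, rfl⟩
      simp [laserGap] at h3
    · refine mem_Sab_of_bounds hr1 hra ?_ ?_
      · dsimp only
        rw [mul_comm r b]
        omega
      · rw [mul_add_one, mul_comm r b]
        dsimp only
        omega
    · refine mem_Sab_of_bounds (r := a - r) (by omega) (by omega) ?_ ?_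
      · dsimp only
        omega
      · rw [mul_add_one]
        dsimp only
        omega

/-- If two diagonals with a common right endpoint violate the laser order, then the third
side of the triangle they span is admissible. -/
theorem admissible_of_laserGap_le (ha : 0 < a) (hab : a < b) (hcop : Nat.Coprime a b)
    {i p j : ℕ} (hi : Admissible a b (i, j)) (hp : Admissible a b (p, j)) (hip : i < p)
    (hle : laserGap a b p j ≤ laserGap a b i j) : Admissible a b (i, p) := by
  rw [admissible_iff ha hab hcop] at hi hp ⊢
  obtain ⟨hi1, hi2, hi3, hi4⟩ := hi
  obtain ⟨hp1, hp2, hp3, hp4⟩ := hp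
  have hpos : 0 < laserGap a b i p := laserGap_pos hcop hip (by omega)
  have h1 := Nat.div_add_mod (a * (j - i)) b
  have h2 := Nat.div_add_mod (a * (j - p)) b
  change b * _ + laserGap a b i j = _ at h1
  change b * _ + laserGap a b p j = _ at h2
  have h3 : a * (p - i) + a * (j - p) = a * (j - i) := by
    rw [← mul_add]
    congr 1
    omega
  have h4 : a * (j - p) / b ≤ a * (j - i) / b := Nat.div_le_div_right (by omega)
  have h5 : b * (a * (j - i) / b - a * (j - p) / b) + b * (a * (j - p) / b) =
      b * (a * (j - i) / b) := by
    rw [← mul_add]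
    congr 1
    omega
  refine ⟨hip, by omega, hpos, ?_⟩
  rw [laserGap_eq (r := a * (j - i) / b - a * (j - p) / b)
    (s := laserGap a b i j - laserGap a b p j) (by omega) (by omega)]
  omega

end Admissibility

section LasersOfDyckPath

variable {a b : ℕ} {D : DyckPath a b}

theorem IsLaserDiag.gap (hab : a < b) {x y k : ℕ} (hy : y < D.h x)
    (hl : IsLaserDiag a b D x y k) :
    b * D.h (k - 1) + laserGap a b x k = b * y + a * (k - x) ∧
      0 < laserGap a b x k ∧ laserGap a b x k < a := by
  obtain ⟨h1, h2, h3, h4⟩ := hl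
  have hxy : b * y + b ≤ b * D.h x := by
    rw [← mul_add_one]
    exact Nat.mul_le_mul_left b hy
  have hk : x + 2 ≤ k := by
    by_contra h
    obtain rfl : k = x + 1 := by omega
    simp at h3
    omega
  have hyk : y ≤ D.h (k - 1) := hy.le.trans (D.mono (by omega))
  have h5 := h4 (k - 2) (by omega) (by omega)
  have h6 : b * D.h (k - 2) ≤ b * D.h (k - 1) := Nat.mul_le_mul_left b (D.mono (by omega))
  have h7 : a * (k - x) = a * (k - 2 + 1 - x) + a := by
    rw [← mul_add_one]
    congr 1
    omega
  have h8 : b * (D.h (k - 1) - y) + b * y = b * D.h (k - 1) := by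
    rw [← mul_add]
    congr 1
    omega
  have h9 : laserGap a b x k = b * y + a * (k - x) - b * D.h (k - 1) :=
    laserGap_eq (r := D.h (k - 1) - y) (by omega) (by omega)
  omega

theorem FD_admissible (ha : 0 < a) (hab : a < b) (hcop : Nat.Coprime a b) {d : ℕ × ℕ}
    (hd : d ∈ FD a b D) : Admissible a b d := by
  obtain ⟨x, k⟩ := d
  obtain ⟨y, ⟨-, -, hy⟩, -, hl⟩ := hd
  obtain ⟨-, h1, h2⟩ := hl.gap hab hy
  exact (admissible_iff ha hab hcop).2 ⟨hl.1, hl.2.1, h1, h2⟩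

/-- A path lies weakly below the starting points of its lasers in every earlier column. -/
theorem BottomNorth.le {x y : ℕ} (h : BottomNorth a b D x y) {u : ℕ} (hu : u < x) :
    D.h u ≤ y := by
  have h1 := h.2.1
  rw [if_neg (by omega)] at h1
  exact (D.mono (by omega)).trans h1

/-- A laser passes strictly below the starting points of the later lasers in its shadow. -/
theorem IsLaserDiag.lt_bottomNorth {x y k x' y' : ℕ} (hl : IsLaserDiag a b D x y k)
    (hx : x < x') (hk : x' < k) (h' : BottomNorth a b D x' y') :
    b * y + a * (x' - x) < b * y' := by
  have h1 := hl.2.2.2 (x' - 1) (by omega) (by omega)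
  have h2 : b * D.h (x' - 1) ≤ b * y' := Nat.mul_le_mul_left b (h'.le (by omega))
  rw [show x' - 1 + 1 - x = x' - x by omega] at h1
  omega

theorem FD_not_overlap {x k x' k' : ℕ} (hd : (x, k) ∈ FD a b D) (hd' : (x', k') ∈ FD a b D)
    (h1 : x < x') (h2 : x' < k) (h3 : k < k') : False := by
  obtain ⟨y, -, -, hl⟩ := hd
  obtain ⟨y', hy', -, hl'⟩ := hd'
  dsimp only at hl hl' hy'
  have h4 := hl.lt_bottomNorth h1 h2 hy'
  have h5 := hl'.2.2.2 (k - 1) (by omega) (by omega)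
  have h6 := hl.2.2.1
  rw [show k - 1 + 1 - x' = k - x' by omega] at h5
  have h7 : a * (x' - x) + a * (k - x') = a * (k - x) := by
    rw [← mul_add]
    congr 1
    omega
  omega

theorem FD_laserGap_lt (hab : a < b) {i p j : ℕ} (hi : (i, j) ∈ FD a b D)
    (hp : (p, j) ∈ FD a b D) (hip : i < p) : laserGap a b i j < laserGap a b p j := by
  obtain ⟨y, hy, -, hl⟩ := hi
  obtain ⟨y', hy', -, hl'⟩ := hp
  dsimp only at hl hl' hy hy'
  have h1 := hl.lt_bottomNorth hip hl'.1 hy'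
  have h2 := hl.gap hab hy.2.2
  have h3 := hl'.gap hab hy'.2.2
  have hpj := hl'.1
  have h4 : a * (p - i) + a * (j - p) = a * (j - i) := by
    rw [← mul_add]
    congr 1
    omega
  omega

end LasersOfDyckPath

section PathOfFace

/-- The farthest vertex joined to `u` by a diagonal of `F` starting at `u`, or `u + 1`. -/
def nextEnd (F : Finset (ℕ × ℕ)) (u : ℕ) : ℕ :=
  max ((F.filter (fun d => d.1 = u)).sup Prod.snd) (u + 1)

theorem lt_nextEnd (F : Finset (ℕ × ℕ)) (u : ℕ) : u < nextEnd F u :=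
  Nat.lt_of_succ_le (le_max_right _ _)

theorem le_nextEnd {F : Finset (ℕ × ℕ)} {u j : ℕ} (h : (u, j) ∈ F) : j ≤ nextEnd F u := by
  have h' : (u, j) ∈ F.filter (fun d => d.1 = u) := Finset.mem_filter.2 ⟨h, rfl⟩
  exact le_max_of_le_left (Finset.le_sup (f := Prod.snd) h')

theorem nextEnd_mem_or (F : Finset (ℕ × ℕ)) (u : ℕ) :
    (u, nextEnd F u) ∈ F ∨ nextEnd F u = u + 1 := by
  rcases max_choice ((F.filter (fun d => d.1 = u)).sup Prod.snd) (u + 1) with h | h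
  · rcases (F.filter (fun d => d.1 = u)).eq_empty_or_nonempty with h0 | h0
    · right
      simp [nextEnd, h0]
    · left
      obtain ⟨d, hd, hj⟩ := Finset.exists_mem_eq_sup _ h0 Prod.snd
      obtain ⟨hdF, hdu⟩ := Finset.mem_filter.1 hd
      rwa [nextEnd, h, hj, ← hdu]
  · exact Or.inr h

/-- The sum of the laser gaps along the path of farthest steps from `u` to `b`. -/
def gapSum (a b : ℕ) (F : Finset (ℕ × ℕ)) (u : ℕ) : ℕ :=
  if u < b then laserGap a b u (nextEnd F u) + gapSum a b F (nextEnd F u) else 0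
termination_by b - u
decreasing_by
  have := lt_nextEnd F u
  omega

variable {a b : ℕ} {F : Finset (ℕ × ℕ)}

theorem gapSum_of_lt {u : ℕ} (hu : u < b) :
    gapSum a b F u = laserGap a b u (nextEnd F u) + gapSum a b F (nextEnd F u) := by
  rw [gapSum, if_pos hu]

theorem gapSum_of_le {u : ℕ} (hu : b ≤ u) : gapSum a b F u = 0 := by
  rw [gapSum, if_neg (by omega)]

theorem nextEnd_le (hF : ∀ d ∈ F, Admissible a b d) {u : ℕ} (hu : u < b) :
    nextEnd F u ≤ b := by
  rcases nextEnd_mem_or F u with h | h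
  · exact (hF _ h).1.2.1
  · omega

theorem dvd_gapSum (hF : ∀ d ∈ F, Admissible a b d) {u : ℕ} (hu : u ≤ b) :
    b ∣ a * u + gapSum a b F u := by
  induction hn : b - u using Nat.strong_induction_on generalizing u with
  | _ n ih =>
  rcases hu.eq_or_lt with rfl | hu'
  · simp [gapSum_of_le le_rfl]
  · have h1 := lt_nextEnd F u
    obtain ⟨c, hc⟩ := ih (b - nextEnd F u) (by omega) (nextEnd_le hF hu') rfl
    have h2 := Nat.div_add_mod (a * (nextEnd F u - u)) b
    change b * _ + laserGap a b u (nextEnd F u) = _ at h2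
    have h3 : a * u + a * (nextEnd F u - u) = a * nextEnd F u := by
      rw [← mul_add]
      congr 1
      omega
    rw [gapSum_of_lt hu', ← Nat.dvd_add_right (dvd_mul_right b (a * (nextEnd F u - u) / b))]
    exact ⟨c, by omega⟩

theorem lt_gapSum (ha : 0 < a) (hab : a < b) (hcop : Nat.Coprime a b)
    (hF : F ∈ (hatAss a b).faces) (hord : LaserOrdered a b F) {i p j : ℕ} (hij : (i, j) ∈ F)
    (hip : i < p) (hpj : p < j) : gapSum a b F j + laserGap a b i j < gapSum a b F p := by
  induction hn : j - p using Nat.strong_induction_on generalizing p with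
  | _ n ih =>
  have hi := (admissible_iff ha hab hcop).1 (hF.1 _ hij)
  have h1 := lt_nextEnd F p
  rw [gapSum_of_lt (show p < b by omega)]
  rcases lt_trichotomy (nextEnd F p) j with h | h | h
  · have := ih (j - nextEnd F p) (by omega) (by omega) h rfl
    omega
  · have : laserGap a b i j < laserGap a b p (nextEnd F p) := by
      rcases nextEnd_mem_or F p with h2 | h2
      · rw [h] at h2 ⊢
        exact hord i p j hij h2 hip
      · rw [h2, laserGap_succ hab]
        exact hi.2.2.2
    rw [h] at this ⊢
    omega
  · rcases nextEnd_mem_or F p with h2 | h2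
    · exact absurd (Or.inl ⟨hip, hpj, h⟩) (hF.2 _ hij _ h2)
    · omega

theorem gapSum_le (ha : 0 < a) (hab : a < b) (hcop : Nat.Coprime a b)
    (hF : F ∈ (hatAss a b).faces) (hord : LaserOrdered a b F) {i j : ℕ} (hij : (i, j) ∈ F) :
    gapSum a b F i ≤ gapSum a b F j + laserGap a b i j := by
  obtain ⟨h1, h2, -, -⟩ := (admissible_iff ha hab hcop).1 (hF.1 _ hij)
  rw [gapSum_of_lt (show i < b by omega)]
  rcases (le_nextEnd hij).eq_or_lt with h | h
  · rw [← h]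
    omega
  · rcases nextEnd_mem_or F i with h3 | h3
    · have := lt_gapSum ha hab hcop hF hord h3 h1 h
      omega
    · omega

theorem gapSum_le_succ (ha : 0 < a) (hab : a < b) (hcop : Nat.Coprime a b)
    (hF : F ∈ (hatAss a b).faces) (hord : LaserOrdered a b F) (u : ℕ) :
    gapSum a b F u ≤ gapSum a b F (u + 1) + a := by
  rcases lt_or_ge u b with hu | hu
  · rcases nextEnd_mem_or F u with h | h
    · have h1 := lt_gapSum ha hab hcop hF hord h (Nat.lt_add_one u)
        (hF.1 _ h).1.1
      rw [gapSum_of_lt hu]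
      omega
    · rw [gapSum_of_lt hu, h, laserGap_succ hab]
      omega
  · rw [gapSum_of_le hu]
    omega

theorem mem_Ass_of_laserOrdered (ha : 0 < a) (hab : a < b) (hcop : Nat.Coprime a b)
    (hF : F ∈ (hatAss a b).faces) (hord : LaserOrdered a b F) : F ∈ (Ass a b).faces := by
  have hb : 0 < b := by omega
  let h : ℕ → ℕ := fun u => if u < b then (a * (u + 1) + gapSum a b F (u + 1)) / b else a
  have hh : ∀ u < b, b * h u = a * (u + 1) + gapSum a b F (u + 1) := fun u hu => by
    simp only [h, if_pos hu]
    exact Nat.mul_div_cancel' (dvd_gapSum hF.1 hu)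
  have hmono : Monotone h := monotone_nat_of_le_succ fun u => by
    rcases lt_trichotomy (u + 1) b with hu | hu | hu
    · refine Nat.le_of_mul_le_mul_left ?_ hb
      rw [hh u (by omega), hh (u + 1) hu]
      have := gapSum_le_succ ha hab hcop hF hord (u + 1)
      rw [mul_add_one a (u + 1)]
      omega
    · refine Nat.le_of_mul_le_mul_left ?_ hb
      rw [hh u (by omega), hu, gapSum_of_le le_rfl]
      simp [h, mul_comm]
    · simp only [h]
      rw [if_neg (by omega), if_neg (by omega)]
  let D : DyckPath a b :=
    { h := h
      mono := hmono
      norm := fun x hx => if_neg (by omega)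
      above := fun x hx => by
        rw [hh x hx]
        omega }
  refine ⟨D, ?_⟩
  rintro ⟨i, j⟩ hij
  obtain ⟨h1, h2, h3, h4⟩ := (admissible_iff ha hab hcop).1 (hF.1 _ hij)
  have h5 : i + 2 ≤ j := (hF.1 _ hij).1.1
  have hj : b * h (j - 1) = a * j + gapSum a b F j := by
    rw [hh (j - 1) (by omega), show j - 1 + 1 = j by omega]
  have hd := Nat.div_add_mod (a * (j - i)) b
  change b * _ + laserGap a b i j = _ at hd
  have hai : a * i + a * (j - i) = a * j := by
    rw [← mul_add]
    congr 1
    omega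
  have hy : b * (h (j - 1) - a * (j - i) / b) =
      a * i + gapSum a b F j + laserGap a b i j := by
    rw [Nat.mul_sub]
    omega
  set y := h (j - 1) - a * (j - i) / b
  refine ⟨y, ⟨by dsimp only; omega, ?_, ?_⟩, ?_, h1, h2, ?_, ?_⟩
  · dsimp only
    split_ifs with hi
    · exact Nat.zero_le _
    · refine Nat.le_of_mul_le_mul_left (show b * h (i - 1) ≤ b * y from ?_) hb
      rw [hy, hh (i - 1) (by omega), show i - 1 + 1 = i by omega]
      have := gapSum_le ha hab hcop hF hord hij
      omega
  · refine Nat.lt_of_mul_lt_mul_left (a := b) ?_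
    change _ < b * h i
    rw [hy, hh i (by omega), mul_add_one]
    have := lt_gapSum ha hab hcop hF hord hij (Nat.lt_add_one i) (by omega)
    omega
  · rintro h6
    have h7 : y = 0 := (Prod.mk.inj h6).2
    rw [h7] at hy
    omega
  · change b * h (j - 1) < _
    dsimp only
    omega
  · intro u hu1 hu2
    change _ < b * h u
    dsimp only at hu1 hu2 ⊢
    have := lt_gapSum ha hab hcop hF hord hij (p := u + 1) (by omega) hu2
    have h6 : a * i + a * (u + 1 - i) = a * (u + 1) := by
      rw [← mul_add]
      congr 1
      omega
    rw [hh u (by omega)]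
    omega

theorem mem_Ass_iff (ha : 0 < a) (hab : a < b) (hcop : Nat.Coprime a b) :
    F ∈ (Ass a b).faces ↔ F ∈ (hatAss a b).faces ∧ LaserOrdered a b F := by
  refine ⟨?_, fun h => mem_Ass_of_laserOrdered ha hab hcop h.1 h.2⟩
  rintro ⟨D, hD⟩
  refine ⟨⟨fun d hd => FD_admissible ha hab hcop (hD d hd), ?_⟩,
    fun i p j hi hp hip => FD_laserGap_lt hab (hD _ hi) (hD _ hp) hip⟩
  rintro ⟨x, k⟩ hd ⟨x', k'⟩ hd' (⟨h1, h2, h3⟩ | ⟨h1, h2, h3⟩)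
  · exact FD_not_overlap (hD _ hd) (hD _ hd') h1 h2 h3
  · exact FD_not_overlap (hD _ hd') (hD _ hd) h1 h2 h3

end PathOfFace

section BadTriangle

/-- The diagonals `ij` and `pj` form the first consecutive violation of the laser order at
the largest right endpoint `j` where `F` violates it. -/
structure IsBadTriangle (a b : ℕ) (F : Finset (ℕ × ℕ)) (i p j : ℕ) : Prop where
  left_mem : (i, j) ∈ F
  right_mem : (p, j) ∈ F
  lt : i < p
  gap_le : laserGap a b p j ≤ laserGap a b i j
  consecutive : ∀ q, (q, j) ∈ F → q < p → q ≤ i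
  first : ∀ q q', (q, j) ∈ F → (q', j) ∈ F → q < q' → q' < p →
    laserGap a b q j < laserGap a b q' j
  last : ∀ q q' j', (q, j') ∈ F → (q', j') ∈ F → q < q' → j < j' →
    laserGap a b q j' < laserGap a b q' j'

variable {a b : ℕ} {F G : Finset (ℕ × ℕ)} {i p j : ℕ}

theorem IsBadTriangle.not_laserOrdered (h : IsBadTriangle a b F i p j) :
    ¬LaserOrdered a b F :=
  fun h' => absurd (h' i p j h.left_mem h.right_mem h.lt) (not_lt.2 h.gap_le)

theorem exists_isBadTriangle (hF : ∀ d ∈ F, Admissible a b d) (h : ¬LaserOrdered a b F) :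
    ∃ i p j, IsBadTriangle a b F i p j := by
  classical
  let Bad : ℕ → ℕ → ℕ → Prop := fun i p j =>
    (i, j) ∈ F ∧ (p, j) ∈ F ∧ i < p ∧ laserGap a b p j ≤ laserGap a b i j
  have hex : ∃ j, ∃ p i, Bad i p j := by
    simp only [LaserOrdered, not_forall, not_lt] at h
    obtain ⟨i, p, j, h1, h2, h3, h4⟩ := h
    exact ⟨j, p, i, h1, h2, h3, h4⟩
  have hbd : ∀ j, (∃ p i, Bad i p j) → j ≤ b := fun j ⟨_, _, h', _⟩ => (hF _ h').1.2.1
  obtain ⟨j₀, hj₀⟩ := hex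
  let j := Nat.findGreatest (fun j => ∃ p i, Bad i p j) b
  have hj : ∃ p i, Bad i p j :=
    Nat.findGreatest_spec (P := fun j => ∃ p i, Bad i p j) (hbd j₀ hj₀) hj₀
  have hjmax : ∀ j', j < j' → ¬∃ p i, Bad i p j' := fun j' hlt hj' =>
    absurd (Nat.le_findGreatest (P := fun j => ∃ p i, Bad i p j) (hbd j' hj') hj')
      (not_le.2 hlt)
  obtain ⟨i₀, h1, h2, h3, h4⟩ := Nat.find_spec hj
  have hpmin : ∀ q, q < Nat.find hj → ¬∃ i, Bad i q j := fun q hq => Nat.find_min hj hq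
  set p := Nat.find hj
  let i := Nat.findGreatest (fun q => (q, j) ∈ F ∧ q < p) p
  have hi : (i, j) ∈ F ∧ i < p :=
    Nat.findGreatest_spec (P := fun q => (q, j) ∈ F ∧ q < p) h3.le ⟨h1, h3⟩
  have himax : ∀ q, (q, j) ∈ F → q < p → q ≤ i := fun q hq hqp =>
    Nat.le_findGreatest (P := fun q => (q, j) ∈ F ∧ q < p) hqp.le ⟨hq, hqp⟩
  have hfirst : ∀ q q', (q, j) ∈ F → (q', j) ∈ F → q < q' → q' < p →
      laserGap a b q j < laserGap a b q' j := fun q q' hq hq' hlt hlt' => by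
    by_contra hc
    exact hpmin q' hlt' ⟨q, hq, hq', hlt, not_lt.1 hc⟩
  refine ⟨i, p, j, hi.1, h2, hi.2, ?_, himax, hfirst, ?_⟩
  · rcases (himax i₀ h1 h3).eq_or_lt with h5 | h5
    · rwa [← h5]
    · exact h4.trans (hfirst i₀ i h1 hi.1 h5 hi.2).le
  · intro q q' j' hq hq' hlt hj'
    by_contra hc
    exact hjmax j' hj' ⟨q', q, hq, hq', hlt, not_lt.1 hc⟩

theorem IsBadTriangle.unique {i' p' j' : ℕ} (h : IsBadTriangle a b F i p j)
    (h' : IsBadTriangle a b F i' p' j') : i = i' ∧ p = p' ∧ j = j' := by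
  obtain rfl : j = j' := by
    rcases lt_trichotomy j j' with hj | hj | hj
    · exact absurd (h.last _ _ _ h'.left_mem h'.right_mem h'.lt hj) (not_lt.2 h'.gap_le)
    · exact hj
    · exact absurd (h'.last _ _ _ h.left_mem h.right_mem h.lt hj) (not_lt.2 h.gap_le)
  obtain rfl : p = p' := by
    rcases lt_trichotomy p p' with hp | hp | hp
    · exact absurd (h'.first _ _ h.left_mem h.right_mem h.lt hp) (not_lt.2 h.gap_le)
    · exact hp
    · exact absurd (h.first _ _ h'.left_mem h'.right_mem h'.lt hp) (not_lt.2 h'.gap_le)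
  exact ⟨le_antisymm (h'.consecutive _ h.left_mem h.lt) (h.consecutive _ h'.left_mem h'.lt),
    rfl, rfl⟩

theorem IsBadTriangle.mono (h : IsBadTriangle a b G i p j) (hi : (i, j) ∈ F)
    (hp : (p, j) ∈ F) (hFG : ∀ q j', j ≤ j' → (q, j') ∈ F → (q, j') ∈ G) :
    IsBadTriangle a b F i p j where
  left_mem := hi
  right_mem := hp
  lt := h.lt
  gap_le := h.gap_le
  consecutive q hq := h.consecutive q (hFG _ _ le_rfl hq)
  first q q' hq hq' := h.first q q' (hFG _ _ le_rfl hq) (hFG _ _ le_rfl hq')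
  last q q' j' hq hq' hlt hj := h.last q q' j' (hFG _ _ hj.le hq) (hFG _ _ hj.le hq') hlt hj

theorem IsBadTriangle.lt_end (h : IsBadTriangle a b F i p j)
    (hF : ∀ d ∈ F, Admissible a b d) : p < j := by
  have : p + 2 ≤ j := (hF _ h.right_mem).1.1
  omega

theorem IsBadTriangle.insert_edge (h : IsBadTriangle a b F i p j) (hpj : p < j) :
    IsBadTriangle a b (insert (i, p) F) i p j :=
  h.mono (Finset.mem_insert_of_mem h.left_mem) (Finset.mem_insert_of_mem h.right_mem)
    fun q j' hj hq => by
      rcases Finset.mem_insert.1 hq with h' | h'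
      · have := (Prod.mk.inj h').2
        omega
      · exact h'

theorem IsBadTriangle.erase_edge (h : IsBadTriangle a b F i p j) (hpj : p < j) :
    IsBadTriangle a b (F.erase (i, p)) i p j := by
  refine h.mono (Finset.mem_erase.2 ⟨fun h' => ?_, h.left_mem⟩)
    (Finset.mem_erase.2 ⟨fun h' => ?_, h.right_mem⟩) fun q j' _ hq => Finset.mem_of_mem_erase hq
  all_goals
    have := (Prod.mk.inj h').2
    omega

theorem IsBadTriangle.insert_mem_hatAss (ha : 0 < a) (hab : a < b) (hcop : Nat.Coprime a b)
    (h : IsBadTriangle a b F i p j) (hF : F ∈ (hatAss a b).faces) :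
    insert (i, p) F ∈ (hatAss a b).faces := by
  have hip := h.lt
  have hpj := h.lt_end hF.1
  have hadm := admissible_of_laserGap_le ha hab hcop (hF.1 _ h.left_mem) (hF.1 _ h.right_mem)
    h.lt h.gap_le
  have hsymm : ∀ d d' : ℕ × ℕ, Crosses d d' → Crosses d' d := fun d d' => Or.symm
  have hnc : ∀ d ∈ F, ¬Crosses (i, p) d := by
    rintro ⟨x, k⟩ hd hc
    have h1 := hF.2 _ h.left_mem _ hd
    have h2 := hF.2 _ h.right_mem _ hd
    have h3 : k = j → x < p → x ≤ i := fun hk hx => h.consecutive x (hk ▸ hd) hx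
    have h4 : x + 2 ≤ k := (hF.1 _ hd).1.1
    simp only [Crosses] at hc h1 h2
    omega
  refine ⟨fun d hd => ?_, fun d hd d' hd' => ?_⟩
  · rcases Finset.mem_insert.1 hd with rfl | hd
    · exact hadm
    · exact hF.1 d hd
  · rcases Finset.mem_insert.1 hd with rfl | hd <;> rcases Finset.mem_insert.1 hd' with rfl | hd'
    · simp only [Crosses]
      omega
    · exact hnc d' hd'
    · exact fun hc => hnc d hd (hsymm _ _ hc)
    · exact hF.2 d hd d' hd'

open Classical in
/-- The third side of the bad triangle of `F`, if there is one. -/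
noncomputable def badEdge (a b : ℕ) (F : Finset (ℕ × ℕ)) : ℕ × ℕ :=
  if h : ∃ d : ℕ × ℕ, ∃ j, IsBadTriangle a b F d.1 d.2 j then h.choose else (0, 0)

theorem IsBadTriangle.badEdge_eq (h : IsBadTriangle a b F i p j) :
    badEdge a b F = (i, p) := by
  have hex : ∃ d : ℕ × ℕ, ∃ j, IsBadTriangle a b F d.1 d.2 j := ⟨(i, p), j, h⟩
  rw [badEdge, dif_pos hex]
  obtain ⟨j', hj'⟩ := hex.choose_spec
  obtain ⟨h1, h2, -⟩ := hj'.unique h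
  exact Prod.ext h1 h2

end BadTriangle

/-- Let `a < b` be coprime positive integers.  The simplicial complex `Âss(a,b)`
collapses onto its subcomplex `Ass(a,b)`. -/
theorem hatAss_collapsesOnto_Ass (a b : ℕ) (ha : 0 < a) (hab : a < b)
    (hcop : Nat.Coprime a b) :
    CollapsesOnto (hatAss a b) (Ass a b) := by
  classical
  have hmem {F : Finset (ℕ × ℕ)} := mem_Ass_iff (F := F) ha hab hcop
  have htri : ∀ F, F ∈ (hatAss a b).faces ∧ F ∉ (Ass a b).faces →
      ∃ i p j, IsBadTriangle a b F i p j ∧ p < j := fun F hF => by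
    obtain ⟨i, p, j, h⟩ :=
      exists_isBadTriangle hF.1.1 fun h => hF.2 (hmem.2 ⟨hF.1, h⟩)
    exact ⟨i, p, j, h, h.lt_end hF.1.1⟩
  have hR : ∀ F, F ∈ ((Finset.range (b + 1) ×ˢ Finset.range (b + 1)).powerset.filter
      fun F => F ∈ (hatAss a b).faces ∧ F ∉ (Ass a b).faces) ↔
        F ∈ (hatAss a b).faces ∧ F ∉ (Ass a b).faces := fun F => by
    rw [Finset.mem_filter, and_iff_right_iff_imp]
    refine fun hF => Finset.mem_powerset.2 fun d hd => ?_
    obtain ⟨h1, h2, -⟩ := (hF.1.1 d hd).1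
    simp only [Finset.mem_product, Finset.mem_range]
    omega
  refine collapsesOnto_of_matching (Ass a b) (badEdge a b) (fun d => d.2 + 1)
    (fun _ => Nat.succ_pos _) _ (hatAss a b) (fun F hF => (hmem.1 hF).1) hR ?_ ?_
  · intro F hF
    rw [hR] at hF
    obtain ⟨i, p, j, h, hpj⟩ := htri F hF
    have h1 := h.insert_edge hpj
    have h2 := h.erase_edge hpj
    rw [h.badEdge_eq, h1.badEdge_eq, h2.badEdge_eq, hR, hR]
    exact ⟨⟨h.insert_mem_hatAss ha hab hcop hF.1, fun h' => h1.not_laserOrdered (hmem.1 h').2⟩,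
      ⟨(hatAss a b).down F hF.1 _ (Finset.erase_subset _ _),
        fun h' => h2.not_laserOrdered (hmem.1 h').2⟩, rfl, rfl⟩
  · intro F _ G hG hFG
    obtain ⟨i, p, j, h, hpj⟩ := htri G ((hR G).1 hG)
    rw [h.badEdge_eq]
    by_cases hi : (i, j) ∈ F
    · by_cases hp : (p, j) ∈ F
      · exact Or.inl (h.mono hi hp fun _ _ _ hq => hFG hq).badEdge_eq
      · exact Or.inr ⟨(p, j), h.right_mem, hp, Nat.succ_lt_succ hpj⟩
    · exact Or.inr ⟨(i, j), h.left_mem, hi, Nat.succ_lt_succ hpj⟩
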